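/- arXiv:2406.16133 — 2 statements merged into one kernel-verified Lean document; each statement's English description precedes it below -/
import Mathlib

section
/- For any two ∃-saturated maximal FOL□-consistent sets Γ, Δ ∈ MC and any elementary disjunction D: □D ∈ Γ if and only if □D ∈ Δ. -/
namespace FOLBoxPaper

/-- Formulas of the language L(∀,□): atoms `P_j(x₁,…,xₙ)` (predicate index and
list of variables), identity `x = y`, negation, implication, universal
quantification, and the modal operator □. Variables are natural numbers. -/
inductive Formula : Type
  | atom : ℕ → List ℕ → Formula
  | eq : ℕ → ℕ → Formula
  | neg : Formula → Formula
  | imp : Formula → Formula → Formula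
  | all : ℕ → Formula → Formula
  | box : Formula → Formula

namespace Formula

/-- Conjunction, defined as usual. -/
def and (A B : Formula) : Formula := neg (imp A (neg B))

/-- Disjunction, defined as usual. -/
def or (A B : Formula) : Formula := imp (neg A) B

/-- Biconditional, defined as usual. -/
def iff (A B : Formula) : Formula := (imp A B).and (imp B A)

/-- ◇A := ¬□¬A. -/
def dia (A : Formula) : Formula := neg (box (neg A))

/-- ∃xA := ¬∀x¬A. -/
def ex (x : ℕ) (A : Formula) : Formula := neg (all x (neg A))

/-- A formula is □-free when it contains no occurrence of □. -/
def BoxFree : Formula → Prop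
  | atom _ _ => True
  | eq _ _ => True
  | neg A => BoxFree A
  | imp A B => BoxFree A ∧ BoxFree B
  | all _ A => BoxFree A
  | box _ => False

/-- `FreeIn x A`: the variable x has at least one ∀□-free occurrence in A,
i.e. an occurrence that is neither in the scope of a quantifier binding x
nor in the scope of □. -/
def FreeIn (x : ℕ) : Formula → Prop
  | atom _ args => x ∈ args
  | eq a b => x = a ∨ x = b
  | neg A => FreeIn x A
  | imp A B => FreeIn x A ∨ FreeIn x B
  | all z A => z ≠ x ∧ FreeIn x A
  | box _ => False

/-- The ∀□-free substitution `A(y/x)`: replace every ∀□-free occurrence of x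
in A by y (occurrences in the scope of □ or of a quantifier binding x are
left untouched). -/
def subst (A : Formula) (y x : ℕ) : Formula :=
  match A with
  | atom j args => atom j (args.map fun z => if z = x then y else z)
  | eq a b => eq (if a = x then y else a) (if b = x then y else b)
  | neg A => neg (subst A y x)
  | imp A B => imp (subst A y x) (subst B y x)
  | all z A => if z = x then all z A else all z (subst A y x)
  | box A => box A

/-- `Substitutable y x A`: the variable y is substitutable for the ∀□-free
occurrences of x in A, i.e. y is not captured by a quantifier when it
replaces x. -/
def Substitutable (y x : ℕ) : Formula → Prop
  | atom _ _ => True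
  | eq _ _ => True
  | neg A => Substitutable y x A
  | imp A B => Substitutable y x A ∧ Substitutable y x B
  | all z A => z = x ∨ ¬ FreeIn x A ∨ (z ≠ y ∧ Substitutable y x A)
  | box _ => True

end Formula

open Formula

/-- A first-order structure with variable domains:
a nonempty set of possible worlds, a nonempty domain of objects for each
world, and a world-relative interpretation of the predicate symbols. -/
structure Structure where
  W : Type
  wNonempty : Nonempty W
  D : W → Type
  dNonempty : ∀ w, Nonempty (D w)
  I : ℕ → (w : W) → List (D w) → Prop

/-- A valuation assigns, to each variable and world, an object of the domain
of that world. -/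
def Valuation (M : Structure) : Type := ℕ → (w : M.W) → M.D w

open Classical in
/-- The variant `v^a_x(w)` of a valuation v at world w: it maps x at w to a
and agrees with v everywhere else. -/
noncomputable def updateVal {M : Structure} (v : Valuation M) (x : ℕ)
    (w : M.W) (a : M.D w) : Valuation M :=
  fun y w' => if h : y = x ∧ w' = w then cast (congrArg M.D h.2.symm) a else v y w'

/-- Satisfaction `M, v, w ⊨ A`. The clause for □ quantifies over all
valuations and all worlds of the structure. -/
def Sat (M : Structure) : Valuation M → M.W → Formula → Prop
  | v, w, .atom j args => M.I j w (args.map fun z => v z w)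
  | v, w, .eq a b => v a w = v b w
  | v, w, .neg A => ¬ Sat M v w A
  | v, w, .imp A B => Sat M v w A → Sat M v w B
  | v, w, .all x A => ∀ a : M.D w, Sat M (updateVal v x w a) w A
  | _, _, .box A => ∀ (v' : Valuation M) (w' : M.W), Sat M v' w' A

/-- `M ⊨ A`: A is satisfied at every valuation and world of M. -/
def Models (M : Structure) (A : Formula) : Prop := ∀ v w, Sat M v w A

/-- Universal structures: M is universal when every □-free formula true
everywhere in M is true everywhere in every structure. -/
def Universal (M : Structure) : Prop :=
  ∀ B, BoxFree B → Models M B → ∀ N : Structure, Models N B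

/-- Logical validity: truth at every valuation and world of every universal
structure. -/
def Valid (A : Formula) : Prop :=
  ∀ M : Structure, Universal M → ∀ (v : Valuation M) (w : M.W), Sat M v w A

/-- FOL: the set of □-free classical first-order theses, i.e. □-free formulas
satisfied at every valuation and world of every structure. -/
def FOL : Set Formula := {A | BoxFree A ∧ ∀ M : Structure, Models M A}

/-- `PropTaut A`: A is an instantiation of a tautology of classical
propositional logic (it is true under every assignment of truth values to
formulas that respects ¬ and →). -/
def PropTaut (A : Formula) : Prop :=
  ∀ f : Formula → Prop,
    (∀ B, f (neg B) ↔ ¬ f B) → (∀ B C, f (imp B C) ↔ (f B → f C)) → f A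

/-- The system FOL□. -/
inductive FOLBox : Formula → Prop
  | taut {A} : PropTaut A → FOLBox A
  | axK {A B} : FOLBox ((box (A.imp B)).imp ((box A).imp (box B)))
  | axT {A} : FOLBox ((box A).imp A)
  | ax5 {A} : FOLBox ((neg (box A)).imp (box (neg (box A))))
  | axAll1 {A : Formula} {x y : ℕ} : Substitutable y x A →
      FOLBox ((all x A).imp (A.subst y x))
  | axAll2 {A B : Formula} {x : ℕ} : ¬ FreeIn x A →
      FOLBox ((all x (A.imp B)).imp (A.imp (all x B)))
  | axId {x : ℕ} : FOLBox (Formula.eq x x)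
  | axEq {A : Formula} {x y : ℕ} : BoxFree A → Substitutable y x A →
      FOLBox (((Formula.eq x y).and A).imp (A.subst y x))
  | axMix {A : Formula} {x : ℕ} : FOLBox ((box A).imp (all x A))
  | axBang {A} : BoxFree A → A ∉ FOL → FOLBox (neg (box A))
  | mp {A B} : FOLBox (A.imp B) → FOLBox A → FOLBox B
  | nec {A} : FOLBox A → FOLBox (box A)

/-- The conjunction of a (nonempty) finite list of formulas. -/
def conjList : List Formula → Formula
  | [] => Formula.eq 0 0
  | [A] => A
  | A :: B :: rest => A.and (conjList (B :: rest))

/-- FOL□-consistency: no finite conjunction of members of Γ has its negation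
in FOL□. -/
def Consistent (Γ : Set Formula) : Prop :=
  ∀ L : List Formula, L ≠ [] → (∀ B ∈ L, B ∈ Γ) → ¬ FOLBox (neg (conjList L))

/-- Maximal FOL□-consistency. -/
def MaxConsistent (Γ : Set Formula) : Prop :=
  Consistent Γ ∧ ∀ A, A ∈ Γ ∨ neg A ∈ Γ

/-- ∃-saturation: whenever ¬∀xA ∈ Γ there is a variable y with
¬A(y/x) ∈ Γ via a ∀□-free substitution. -/
def Saturated (Γ : Set Formula) : Prop :=
  ∀ (x : ℕ) (A : Formula), neg (all x A) ∈ Γ →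
    ∃ y : ℕ, Substitutable y x A ∧ neg (A.subst y x) ∈ Γ

/-- MC: the family of all ∃-saturated maximal FOL□-consistent sets. -/
def MC : Set (Set Formula) := {Γ | Saturated Γ ∧ MaxConsistent Γ}

/-- An elementary disjunction: a formula of the form
`A ∨ ◇B ∨ □C₁ ∨ … ∨ □Cₙ` with A, B, C₁, …, Cₙ □-free. -/
def ElemDisj (D : Formula) : Prop :=
  ∃ (A B : Formula) (Cs : List Formula),
    BoxFree A ∧ BoxFree B ∧ (∀ C ∈ Cs, BoxFree C) ∧
    D = (Cs.map Formula.box).foldl Formula.or (A.or B.dia)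

/-- A conjunctive form: a conjunction of elementary disjunctions. -/
def ConjForm (F : Formula) : Prop :=
  ∃ Ds : List Formula, Ds ≠ [] ∧ (∀ D ∈ Ds, ElemDisj D) ∧ F = conjList Ds

/-- The worlds of the canonical structure: members of MC. -/
def MCW : Type := {Γ : Set Formula // Γ ∈ MC}

/-- The relation ∼_Γ on variables: x ∼_Γ y iff the formula x = y belongs
to Γ. -/
def canonRel (Γ : MCW) (x y : ℕ) : Prop := Formula.eq x y ∈ Γ.val

/-- The canonical structure 𝒜^MC: worlds are the members of MC, the domain
of a world Γ consists of the classes [x]_{∼_Γ} of variables, and a predicate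
holds of such classes iff the corresponding atomic formula belongs to Γ. -/
noncomputable def canonicalStructure (h : Nonempty MCW) : Structure where
  W := MCW
  wNonempty := h
  D := fun Γ => Quot (canonRel Γ)
  dNonempty := fun Γ => ⟨Quot.mk _ 0⟩
  I := fun j Γ ds =>
    ∃ xs : List ℕ, ds = xs.map (Quot.mk (canonRel Γ)) ∧ Formula.atom j xs ∈ Γ.val

/-- The canonical valuation v^MC: v^MC(x, Γ) = [x]_{∼_Γ}. -/
noncomputable def canonicalVal (h : Nonempty MCW) : Valuation (canonicalStructure h) :=
  fun x Γ => Quot.mk (canonRel Γ) x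

namespace Formula

/-- A strict upper bound for the variables occurring in a formula outside the scope of □. -/
def varBound : Formula → ℕ
  | atom _ args => args.sum + 1
  | eq a b => a + b + 1
  | neg A => varBound A
  | imp A B => max (varBound A) (varBound B)
  | all z A => max (z + 1) (varBound A)
  | box _ => 0

/-- The number of connectives, quantifiers and modal operators of a formula. -/
def size : Formula → ℕ
  | atom _ _ => 0
  | eq _ _ => 0
  | neg A => size A + 1
  | imp A B => size A + size B + 1
  | all _ A => size A + 1
  | box A => size A + 1

/-- A numerical code for formulas. -/
def code : Formula → ℕ
  | atom j args => Nat.pair 0 (Nat.pair j (Encodable.encode args))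
  | eq a b => Nat.pair 1 (Nat.pair a b)
  | neg A => Nat.pair 2 (code A)
  | imp A B => Nat.pair 3 (Nat.pair (code A) (code B))
  | all z A => Nat.pair 4 (Nat.pair z (code A))
  | box A => Nat.pair 5 (code A)

theorem code_injective : Function.Injective code := by
  intro A
  induction A with
  | atom j l => intro B h; cases B <;> simp_all [code, Nat.pair_eq_pair]
  | eq a b => intro B h; cases B <;> simp_all [code, Nat.pair_eq_pair]
  | neg A ih =>
    intro B h
    cases B <;> simp [code, Nat.pair_eq_pair] at h
    rw [ih h]
  | imp A B ihA ihB =>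
    intro C h
    cases C <;> simp [code, Nat.pair_eq_pair] at h
    rw [ihA h.1, ihB h.2]
  | all z A ih =>
    intro B h
    cases B <;> simp [code, Nat.pair_eq_pair] at h
    rw [h.1, ih h.2]
  | box A ih =>
    intro B h
    cases B <;> simp [code, Nat.pair_eq_pair] at h
    rw [ih h]

instance : Countable Formula := code_injective.countable

instance : Nonempty Formula := ⟨eq 0 0⟩

theorem size_subst (A : Formula) (y x : ℕ) : (A.subst y x).size = A.size := by
  induction A with
  | all z A ih => simp only [subst]; split_ifs <;> simp [size, ih]
  | _ => simp_all [subst, size]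

theorem BoxFree.subst {A : Formula} (h : BoxFree A) (y x : ℕ) : BoxFree (A.subst y x) := by
  induction A with
  | all z A ih => simp only [Formula.subst]; split_ifs <;> simp_all [BoxFree]
  | _ => simp_all [Formula.subst, BoxFree]

theorem not_freeIn_of_varBound_le {A : Formula} {y : ℕ} (h : A.varBound ≤ y) : ¬ FreeIn y A := by
  induction A with
  | atom j l =>
    intro hy
    have := List.single_le_sum (l := l) (by simp) y hy
    simp only [varBound] at h
    omega
  | eq a b => simp only [varBound, FreeIn] at *; omega
  | neg A ih => exact ih h
  | imp A B ihA ihB =>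
    simp only [varBound, max_le_iff] at h
    simp [FreeIn, ihA h.1, ihB h.2]
  | all z A ih =>
    simp only [varBound, max_le_iff] at h
    simp [FreeIn, ih h.2]
  | box A => simp [FreeIn]

theorem substitutable_of_varBound_le {A : Formula} {y : ℕ} (x : ℕ) (h : A.varBound ≤ y) :
    Substitutable y x A := by
  induction A with
  | atom j l => trivial
  | eq a b => trivial
  | neg A ih => exact ih h
  | imp A B ihA ihB =>
    simp only [varBound, max_le_iff] at h
    exact ⟨ihA h.1, ihB h.2⟩
  | all z A ih =>
    simp only [varBound, max_le_iff] at h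
    exact Or.inr (Or.inr ⟨by omega, ih h.2⟩)
  | box A => trivial

theorem substitutable_of_not_freeIn {A : Formula} {x : ℕ} (y : ℕ) (h : ¬ FreeIn x A) :
    Substitutable y x A := by
  induction A with
  | atom j l => trivial
  | eq a b => trivial
  | neg A ih => exact ih h
  | imp A B ihA ihB =>
    simp only [FreeIn, not_or] at h
    exact ⟨ihA h.1, ihB h.2⟩
  | all z A ih =>
    simp only [FreeIn] at h
    simp only [Substitutable]
    tauto
  | box A => trivial

theorem subst_of_not_freeIn {A : Formula} {x : ℕ} (y : ℕ) (h : ¬ FreeIn x A) :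
    A.subst y x = A := by
  induction A with
  | atom j l =>
    simp only [FreeIn] at h
    simp only [subst, atom.injEq, true_and]
    conv_rhs => rw [← List.map_id l]
    refine List.map_congr_left fun z hz => ?_
    rw [if_neg (by rintro rfl; exact h hz), id]
  | eq a b =>
    simp only [FreeIn, not_or] at h
    simp [subst, Ne.symm h.1, Ne.symm h.2]
  | neg A ih => simp only [subst]; rw [ih h]
  | imp A B ihA ihB =>
    simp only [FreeIn, not_or] at h
    simp only [subst]
    rw [ihA h.1, ihB h.2]
  | all z A ih =>
    simp only [subst]
    split_ifs with hz
    · rfl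
    · rw [ih fun hf => h ⟨hz, hf⟩]
  | box A => rfl

theorem not_freeIn_subst {x y : ℕ} (hxy : x ≠ y) (A : Formula) : ¬ FreeIn x (A.subst y x) := by
  induction A with
  | atom j l =>
    simp only [subst, FreeIn, List.mem_map, not_exists, not_and]
    intro z _
    split_ifs with h
    · exact hxy.symm
    · exact h
  | eq a b => simp only [subst, FreeIn]; split_ifs <;> omega
  | neg A ih => exact ih
  | imp A B ihA ihB => simp only [subst, FreeIn]; tauto
  | all z A ih => simp only [subst]; split_ifs with h <;> simp [FreeIn, h, ih]
  | box A => simp [subst, FreeIn]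

theorem substitutable_subst_of_varBound_le {A : Formula} {y : ℕ} (x : ℕ) (h : A.varBound ≤ y) :
    Substitutable x y (A.subst y x) := by
  induction A with
  | atom j l => trivial
  | eq a b => trivial
  | neg A ih => exact ih h
  | imp A B ihA ihB =>
    simp only [varBound, max_le_iff] at h
    exact ⟨ihA h.1, ihB h.2⟩
  | all z A ih =>
    simp only [varBound, max_le_iff] at h
    simp only [subst]
    split_ifs with hz
    · exact Or.inr (Or.inl (not_freeIn_of_varBound_le h.2))
    · exact Or.inr (Or.inr ⟨hz, ih h.2⟩)
  | box A => trivial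

theorem subst_subst_of_varBound_le {A : Formula} {y : ℕ} (x : ℕ) (h : A.varBound ≤ y) :
    (A.subst y x).subst x y = A := by
  induction A with
  | atom j l =>
    simp only [subst, List.map_map, atom.injEq, true_and]
    conv_rhs => rw [← List.map_id l]
    refine List.map_congr_left fun z hz => ?_
    have hzy : z ≠ y := by
      rintro rfl
      exact not_freeIn_of_varBound_le h hz
    by_cases hzx : z = x <;> simp [hzx, hzy]
  | eq a b =>
    simp only [varBound] at h
    simp only [subst, eq.injEq]
    constructor <;> split_ifs <;> omega
  | neg A ih => simp only [subst]; rw [ih h]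
  | imp A B ihA ihB =>
    simp only [varBound, max_le_iff] at h
    simp only [subst]
    rw [ihA h.1, ihB h.2]
  | all z A ih =>
    simp only [varBound, max_le_iff] at h
    have hzy : z ≠ y := by omega
    simp only [subst]
    split_ifs with hz
    · simp only [subst, if_neg hzy]
      rw [subst_of_not_freeIn x (not_freeIn_of_varBound_le h.2)]
    · simp only [subst, if_neg hzy]
      rw [ih h.2]
  | box A => rfl

end Formula

section Semantics

variable {M : Structure}

@[simp]
theorem updateVal_self (v : Valuation M) (x : ℕ) (w : M.W) (a : M.D w) :
    updateVal v x w a x w = a := by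
  simp [updateVal]

theorem updateVal_of_ne (v : Valuation M) {x y : ℕ} (h : y ≠ x) (w w' : M.W) (a : M.D w) :
    updateVal v x w a y w' = v y w' := by
  simp [updateVal, h]

theorem updateVal_idem (v : Valuation M) (x : ℕ) (w : M.W) (a b : M.D w) :
    updateVal (updateVal v x w a) x w b = updateVal v x w b := by
  funext y w'
  simp only [updateVal]
  split_ifs <;> rfl

theorem updateVal_comm (v : Valuation M) {x y : ℕ} (hxy : x ≠ y) (w : M.W) (a b : M.D w) :
    updateVal (updateVal v x w a) y w b = updateVal (updateVal v y w b) x w a := by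
  funext z w'
  simp only [updateVal]
  split_ifs with h₁ h₂
  · exact absurd (h₂.1.symm.trans h₁.1) hxy
  all_goals rfl

theorem sat_subst_iff {A : Formula} {x y : ℕ} (hA : BoxFree A) (h : A.varBound ≤ y)
    (v : Valuation M) (w : M.W) :
    Sat M v w (A.subst y x) ↔ Sat M (updateVal v x w (v y w)) w A := by
  have key : ∀ z, v (if z = x then y else z) w = updateVal v x w (v y w) z w := by
    intro z
    split_ifs with hz
    · rw [hz, updateVal_self]
    · rw [updateVal_of_ne v hz]
  induction A generalizing v with
  | atom j l =>
    simp only [Formula.subst, Sat, List.map_map, Function.comp_def, key]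
  | eq a b => simp only [Formula.subst, Sat, key]
  | neg A ih =>
    exact not_congr (ih hA h v key)
  | imp A B ihA ihB =>
    simp only [varBound, max_le_iff] at h
    exact imp_congr (ihA hA.1 h.1 v key) (ihB hA.2 h.2 v key)
  | all z A ih =>
    simp only [varBound, max_le_iff] at h
    have hyz : y ≠ z := by omega
    simp only [Formula.subst]
    split_ifs with hz
    · subst hz
      simp only [Sat, updateVal_idem]
    · simp only [Sat]
      refine forall_congr' fun a => ?_
      have hval : updateVal (updateVal v z w a) x w (updateVal v z w a y w) =
          updateVal (updateVal v x w (v y w)) z w a :=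
        (congrArg (updateVal _ x w) (updateVal_of_ne v hyz w w a)).trans
          (updateVal_comm v hz w a _)
      rw [← hval]
      refine ih hA h.2 _ fun u => ?_
      split_ifs with hu
      · rw [hu, updateVal_self]
      · rw [updateVal_of_ne _ hu]
  | box A => exact hA.elim

end Semantics

section Provability

theorem FOLBox.mp₂ {A B C : Formula} (h : FOLBox (A.imp (B.imp C))) (hA : FOLBox A)
    (hB : FOLBox B) : FOLBox C :=
  (h.mp hA).mp hB

theorem FOLBox.gen {A : Formula} (x : ℕ) (h : FOLBox A) : FOLBox (all x A) :=
  FOLBox.axMix.mp h.nec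

theorem FOLBox.imp_trans {A B C : Formula} (h₁ : FOLBox (A.imp B)) (h₂ : FOLBox (B.imp C)) :
    FOLBox (A.imp C) :=
  FOLBox.mp₂ (.taut (by intro f hn hi; simp only [hi]; tauto)) h₁ h₂

theorem FOLBox.and_left (A B : Formula) : FOLBox ((A.and B).imp A) :=
  .taut (by intro f hn hi; simp only [Formula.and, hi, hn]; tauto)

theorem FOLBox.and_right (A B : Formula) : FOLBox ((A.and B).imp B) :=
  .taut (by intro f hn hi; simp only [Formula.and, hi, hn]; tauto)

theorem FOLBox.imp_all {A B : Formula} {x : ℕ} (hx : ¬ FreeIn x A) (h : FOLBox (A.imp B)) :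
    FOLBox (A.imp (all x B)) :=
  (FOLBox.axAll2 hx).mp (h.gen x)

/-- Renaming of a bound variable by a fresh one. -/
theorem FOLBox.all_subst_imp_all {A : Formula} {x y : ℕ} (hxy : x ≠ y) (h : A.varBound ≤ y) :
    FOLBox ((all y (A.subst y x)).imp (all x A)) := by
  refine FOLBox.imp_all (fun hf => not_freeIn_subst hxy A hf.2) ?_
  have := FOLBox.axAll1 (substitutable_subst_of_varBound_le x h)
  rwa [subst_subst_of_varBound_le x h] at this

/-- Substitutivity of identicals at the occurrences marked by the auxiliary variable `u`. -/
theorem FOLBox.eq_imp_subst {A : Formula} {x y u : ℕ} (hA : BoxFree A) (huy : u ≠ y)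
    (hx : Substitutable x u A) (hy : Substitutable y u A) :
    FOLBox ((Formula.eq x y).imp ((A.subst x u).imp (A.subst y u))) := by
  have hf := not_freeIn_subst huy A
  have h₁ := (FOLBox.axEq hA hy).gen u
  have h₂ := (FOLBox.axAll1 (y := x)
    (by exact ⟨⟨trivial, hx⟩, substitutable_of_not_freeIn x hf⟩)).mp h₁
  simp only [Formula.and, Formula.subst, if_true, if_neg huy.symm,
    subst_of_not_freeIn x hf] at h₂
  exact FOLBox.mp (.taut (by intro f hn hi; simp only [hi, hn]; tauto)) h₂

theorem FOLBox.eq_euclidean (x y z : ℕ) :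
    FOLBox ((Formula.eq x y).imp ((Formula.eq x z).imp (Formula.eq y z))) := by
  have := FOLBox.eq_imp_subst (A := Formula.eq (y + z + 1) z) (x := x) (y := y) (u := y + z + 1)
    trivial (by omega) trivial trivial
  have hz : z ≠ y + z + 1 := by omega
  simpa only [Formula.subst, if_true, if_neg hz] using this

theorem FOLBox.eq_imp_atom (j : ℕ) (l₁ l₂ : List ℕ) (x y : ℕ) :
    FOLBox ((Formula.eq x y).imp
      ((atom j (l₁ ++ x :: l₂)).imp (atom j (l₁ ++ y :: l₂)))) := by
  obtain ⟨u, hu⟩ : ∃ u, u = (l₁ ++ y :: l₂).sum + 1 := ⟨_, rfl⟩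
  have hne : ∀ z ∈ l₁ ++ y :: l₂, z ≠ u := fun z hz => by
    have := List.single_le_sum (l := l₁ ++ y :: l₂) (by simp) z hz
    omega
  have hmap : ∀ t, (l₁ ++ u :: l₂).map (fun z => if z = u then t else z) = l₁ ++ t :: l₂ := by
    intro t
    have h : ∀ l : List ℕ, (∀ z ∈ l, z ≠ u) → l.map (fun z => if z = u then t else z) = l := by
      intro l hl
      conv_rhs => rw [← List.map_id l]
      exact List.map_congr_left fun z hz => by rw [if_neg (hl z hz), id]
    rw [List.map_append, List.map_cons, if_pos rfl, h l₁ fun z hz => hne z (by simp [hz]),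
      h l₂ fun z hz => hne z (by simp [hz])]
  have := FOLBox.eq_imp_subst (A := atom j (l₁ ++ u :: l₂)) (x := x) (y := y) (u := u)
    trivial (hne y (by simp)).symm trivial trivial
  simpa only [Formula.subst, hmap] using this

end Provability

section Completeness

theorem exists_henkin_extension {Θ : Formula} (hΘ : ¬ FOLBox (neg Θ)) (k x : ℕ) (B : Formula) :
    ∃ y, k ≤ y ∧ B.varBound ≤ y ∧
      ¬ FOLBox (neg (Θ.and ((B.subst y x).imp (all x B)))) := by
  refine ⟨k + Θ.varBound + B.varBound + x + 1, by omega, by omega, fun h => hΘ ?_⟩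
  set y := k + Θ.varBound + B.varBound + x + 1 with hy
  have h₁ : FOLBox (Θ.imp (B.subst y x)) :=
    FOLBox.mp (.taut (by intro f hn hi; simp only [Formula.and, hi, hn]; tauto)) h
  have h₂ : FOLBox (Θ.imp (neg (all x B))) :=
    FOLBox.mp (.taut (by intro f hn hi; simp only [Formula.and, hi, hn]; tauto)) h
  have h₃ := (FOLBox.imp_all (not_freeIn_of_varBound_le (by omega)) h₁).imp_trans
    (FOLBox.all_subst_imp_all (by omega) (by omega))
  exact FOLBox.mp₂ (.taut (by intro f hn hi; simp only [hi, hn]; tauto)) h₂ h₃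

theorem exists_deciding_extension {Θ : Formula} (hΘ : ¬ FOLBox (neg Θ)) (B : Formula) :
    ∃ Θ', ¬ FOLBox (neg Θ') ∧ FOLBox (Θ'.imp Θ) ∧
      (FOLBox (Θ'.imp B) ∨ FOLBox (Θ'.imp (neg B))) := by
  by_cases h : FOLBox (neg (Θ.and B))
  · refine ⟨Θ.and (neg B), fun h' => hΘ ?_, FOLBox.and_left _ _, Or.inr (FOLBox.and_right _ _)⟩
    exact FOLBox.mp₂ (.taut (by intro f hn hi; simp only [Formula.and, hi, hn]; tauto)) h h'
  · exact ⟨Θ.and B, h, FOLBox.and_left _ _, Or.inl (FOLBox.and_right _ _)⟩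

/-- A Henkin theory: a consistent, complete, deductively closed set of formulas with arbitrarily
large witnesses for universally quantified formulas. -/
structure HenkinTheory (T : Set Formula) : Prop where
  of_provable : ∀ {B}, FOLBox B → B ∈ T
  mp : ∀ {B C}, B.imp C ∈ T → B ∈ T → C ∈ T
  neg_mem_iff : ∀ {B}, neg B ∈ T ↔ B ∉ T
  exists_witness : ∀ (k x : ℕ) (B : Formula),
    ∃ y, k ≤ y ∧ B.varBound ≤ y ∧ (B.subst y x).imp (all x B) ∈ T

theorem exists_henkinTheory {A : Formula} (hA : ¬ FOLBox (neg A)) :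
    ∃ T : Set Formula, A ∈ T ∧ HenkinTheory T := by
  have step : ∀ (Θ : {Θ // ¬ FOLBox (neg Θ)}) (t : ℕ × ℕ × Formula),
      ∃ Θ' : {Θ // ¬ FOLBox (neg Θ)}, FOLBox (Θ'.1.imp Θ.1) ∧
        (FOLBox (Θ'.1.imp t.2.2) ∨ FOLBox (Θ'.1.imp (neg t.2.2))) ∧
        ∃ y, t.1 ≤ y ∧ t.2.2.varBound ≤ y ∧
          FOLBox (Θ'.1.imp ((t.2.2.subst y t.2.1).imp (all t.2.1 t.2.2))) := by
    rintro ⟨Θ, hΘ⟩ ⟨k, x, B⟩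
    obtain ⟨Θ₁, hΘ₁, hle, hdec⟩ := exists_deciding_extension hΘ B
    obtain ⟨y, hk, hB, hcon⟩ := exists_henkin_extension hΘ₁ k x B
    have hl := FOLBox.and_left Θ₁ ((B.subst y x).imp (all x B))
    exact ⟨⟨_, hcon⟩, hl.imp_trans hle, hdec.imp hl.imp_trans hl.imp_trans, y, hk, hB,
      FOLBox.and_right _ _⟩
  choose next hnext using step
  obtain ⟨e, he⟩ := exists_surjective_nat (ℕ × ℕ × Formula)
  let s : ℕ → {Θ // ¬ FOLBox (neg Θ)} := fun n =>
    Nat.rec ⟨A, hA⟩ (fun n Θ => next Θ (e n)) n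
  have hs : ∀ n, s (n + 1) = next (s n) (e n) := fun _ => rfl
  have mono : ∀ {m n}, m ≤ n → FOLBox ((s n).1.imp (s m).1) := by
    intro m n hmn
    induction hmn with
    | refl => exact .taut (by intro f hn hi; simp only [hi]; tauto)
    | @step n _ ih => exact FOLBox.imp_trans (by rw [Nat.succ_eq_add_one, hs]; exact (hnext _ _).1) ih
  have hmp : ∀ {B C}, (∃ n, FOLBox ((s n).1.imp (B.imp C))) → (∃ n, FOLBox ((s n).1.imp B)) →
      ∃ n, FOLBox ((s n).1.imp C) := by
    rintro B C ⟨m, hm⟩ ⟨n, hn⟩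
    refine ⟨max m n, FOLBox.mp₂ (.taut ?_) ((mono (le_max_left m n)).imp_trans hm)
      ((mono (le_max_right m n)).imp_trans hn)⟩
    intro f hn hi
    simp only [hi]
    tauto
  have hthm : ∀ {B}, FOLBox B → ∃ n, FOLBox ((s n).1.imp B) := fun h =>
    ⟨0, FOLBox.mp (.taut (by intro f hn hi; simp only [hi]; tauto)) h⟩
  refine ⟨{B | ∃ n, FOLBox ((s n).1.imp B)}, ⟨0, .taut (by intro f hn hi; simp only [hi, s]; tauto)⟩,
    hthm, hmp, ?_, ?_⟩
  · intro B
    constructor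
    · rintro ⟨m, hm⟩ ⟨n, hn⟩
      refine (s (max m n)).2 (FOLBox.mp₂ (.taut ?_) ((mono (le_max_left m n)).imp_trans hm)
        ((mono (le_max_right m n)).imp_trans hn))
      intro f hn hi
      simp only [hi, hn]
      tauto
    · intro hB
      obtain ⟨n, hn⟩ := he (0, 0, B)
      have := (hnext (s n) (e n)).2.1
      rw [← hs, hn] at this
      exact this.elim (fun h => (hB ⟨n + 1, h⟩).elim) fun h => ⟨n + 1, h⟩
  · intro k x B
    obtain ⟨n, hn⟩ := he (k, x, B)
    obtain ⟨y, hk, hB, h⟩ := (hnext (s n) (e n)).2.2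
    rw [← hs] at h
    rw [hn] at hk hB h
    exact ⟨y, hk, hB, n + 1, h⟩

namespace HenkinTheory

variable {T : Set Formula}

theorem imp_mem_iff (hT : HenkinTheory T) {B C : Formula} :
    B.imp C ∈ T ↔ (B ∈ T → C ∈ T) := by
  refine ⟨fun h hB => hT.mp h hB, fun h => ?_⟩
  by_cases hB : B ∈ T
  · exact hT.mp (hT.of_provable (.taut (by intro f hn hi; simp only [hi]; tauto))) (h hB)
  · exact hT.mp (hT.of_provable (.taut (by intro f hn hi; simp only [hi, hn]; tauto)))
      (hT.neg_mem_iff.2 hB)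

theorem eq_refl (hT : HenkinTheory T) (x : ℕ) : Formula.eq x x ∈ T :=
  hT.of_provable .axId

theorem eq_euclidean (hT : HenkinTheory T) {x y z : ℕ} (hxy : Formula.eq x y ∈ T)
    (hxz : Formula.eq x z ∈ T) : Formula.eq y z ∈ T :=
  hT.mp (hT.mp (hT.of_provable (FOLBox.eq_euclidean x y z)) hxy) hxz

theorem eq_symm (hT : HenkinTheory T) {x y : ℕ} (hxy : Formula.eq x y ∈ T) :
    Formula.eq y x ∈ T :=
  hT.eq_euclidean hxy (hT.eq_refl x)

/-- Provable identity of variables in a Henkin theory. -/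
def setoid (hT : HenkinTheory T) : Setoid ℕ where
  r x y := Formula.eq x y ∈ T
  iseqv := ⟨hT.eq_refl, hT.eq_symm, fun h => hT.eq_euclidean (hT.eq_symm h)⟩

theorem atom_mem (hT : HenkinTheory T) {j : ℕ} {f g : ℕ → ℕ}
    (hfg : ∀ z, Formula.eq (f z) (g z) ∈ T) (l₁ l : List ℕ)
    (h : atom j (l₁ ++ l.map f) ∈ T) : atom j (l₁ ++ l.map g) ∈ T := by
  induction l generalizing l₁ with
  | nil => exact h
  | cons z l ih =>
    have h' := hT.mp (hT.mp (hT.of_provable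
      (FOLBox.eq_imp_atom j l₁ (l.map f) (f z) (g z))) (hfg z)) h
    have := ih (l₁ ++ [g z]) (by simpa using h')
    simpa using this

/-- The one-world term structure of a Henkin theory. -/
noncomputable def termStructure (hT : HenkinTheory T) : Structure where
  W := Unit
  wNonempty := ⟨()⟩
  D _ := Quotient hT.setoid
  dNonempty _ := ⟨Quotient.mk _ 0⟩
  I j _ ds := atom j (ds.map Quotient.out) ∈ T

/-- Each variable denotes its own class in the term structure. -/
def termVal (hT : HenkinTheory T) : Valuation hT.termStructure :=
  fun x _ => Quotient.mk hT.setoid x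

theorem exists_large_eq (hT : HenkinTheory T) (k y : ℕ) :
    ∃ z, k ≤ z ∧ Formula.eq z y ∈ T := by
  obtain ⟨z, hk, _, h⟩ := hT.exists_witness k (y + 1) (neg (Formula.eq (y + 1) y))
  refine ⟨z, hk, ?_⟩
  have hne : y ≠ y + 1 := by omega
  simp only [Formula.subst, if_true, if_neg hne] at h
  by_contra hz
  have h₁ := hT.mp h (hT.neg_mem_iff.2 hz)
  have h₂ := hT.mp (hT.of_provable
    (FOLBox.axAll1 (A := neg (Formula.eq (y + 1) y)) (y := y) trivial)) h₁
  simp only [Formula.subst, if_true, if_neg hne] at h₂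
  exact hT.neg_mem_iff.1 h₂ (hT.eq_refl y)

theorem sat_iff_mem (hT : HenkinTheory T) {A : Formula} (hA : BoxFree A) :
    Sat hT.termStructure hT.termVal () A ↔ A ∈ T := by
  induction hn : A.size using Nat.strong_induction_on generalizing A with
  | _ n ih =>
  subst hn
  cases A with
  | atom j l =>
    have hout : ∀ z, Formula.eq (Quotient.mk hT.setoid z).out z ∈ T := fun z =>
      Quotient.exact (s := hT.setoid) (Quotient.out_eq _)
    have hmap : (l.map fun z => hT.termVal z ()).map Quotient.out =
        l.map fun z => (Quotient.mk hT.setoid z).out :=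
      List.map_map
    change atom j ((l.map fun z => hT.termVal z ()).map Quotient.out) ∈ T ↔ _
    rw [hmap]
    constructor
    · intro h
      simpa using hT.atom_mem (g := id) hout [] l h
    · intro h
      exact hT.atom_mem (f := id) (fun z => hT.eq_symm (hout z)) [] l (by simpa using h)
  | eq a b => exact Quotient.eq (r := hT.setoid)
  | neg A =>
    exact (not_congr (ih A.size (by simp [size]) (A := A) hA rfl)).trans hT.neg_mem_iff.symm
  | imp A B =>
    exact (imp_congr (ih A.size (by simp only [size]; omega) hA.1 rfl)
      (ih B.size (by simp only [size]; omega) hA.2 rfl)).trans hT.imp_mem_iff.symm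
  | box A => exact hA.elim
  | all x A =>
    have hA' : BoxFree A := hA
    have inst : ∀ y, A.varBound ≤ y →
        (Sat hT.termStructure (updateVal hT.termVal x () (hT.termVal y ())) () A ↔
          A.subst y x ∈ T) := fun y hy =>
      (sat_subst_iff hA' hy hT.termVal ()).symm.trans
        (ih A.size (by simp [size]) (hA'.subst y x) (size_subst A y x))
    simp only [Sat]
    constructor
    · intro h
      obtain ⟨y, _, hy, hw⟩ := hT.exists_witness 0 x A
      exact hT.mp hw ((inst y hy).1 (h _))
    · intro h a
      induction a using Quotient.inductionOn with
      | _ y =>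
      obtain ⟨z, hz, hzy⟩ := hT.exists_large_eq A.varBound y
      have hval : hT.termVal z () = Quotient.mk hT.setoid y :=
        Quotient.sound (s := hT.setoid) hzy
      have := (inst z hz).2 (hT.mp (hT.of_provable
        (FOLBox.axAll1 (substitutable_of_varBound_le x hz))) h)
      rwa [hval] at this

end HenkinTheory

/-- Gödel completeness: every valid □-free formula is a theorem of FOL□. -/
theorem FOLBox.of_mem_FOL {A : Formula} (hA : A ∈ FOL) : FOLBox A := by
  by_contra h
  obtain ⟨T, hmem, hT⟩ := exists_henkinTheory (A := neg A) fun h' =>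
    h (FOLBox.mp (.taut (by intro f hn hi; simp only [hi, hn]; tauto)) h')
  exact hT.neg_mem_iff.1 hmem ((hT.sat_iff_mem hA.1).1 (hA.2 _ _ _))

end Completeness

theorem FOLBox.box_or_neg_box {A : Formula} (hA : BoxFree A) :
    FOLBox (box A) ∨ FOLBox (neg (box A)) := by
  by_cases h : A ∈ FOL
  · exact Or.inl (FOLBox.of_mem_FOL h).nec
  · exact Or.inr (FOLBox.axBang hA h)

/-- An elementary disjunction is provable or provably equivalent to a □-free formula. -/
theorem ElemDisj.provable_or_equiv_boxFree {D : Formula} (hD : ElemDisj D) :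
    FOLBox D ∨ ∃ A, BoxFree A ∧ FOLBox (D.imp A) ∧ FOLBox (A.imp D) := by
  obtain ⟨A, B, Cs, hA, hB, hCs, rfl⟩ := hD
  have base : FOLBox (A.or B.dia) ∨
      ∃ A', BoxFree A' ∧ FOLBox ((A.or B.dia).imp A') ∧ FOLBox (A'.imp (A.or B.dia)) := by
    rcases FOLBox.box_or_neg_box (A := neg B) hB with h | h
    · exact Or.inr ⟨A, hA,
        FOLBox.mp (.taut (by intro f hn hi; simp only [Formula.or, dia, hi, hn]; tauto)) h,
        .taut (by intro f hn hi; simp only [Formula.or, dia, hi, hn]; tauto)⟩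
    · exact Or.inl
        (FOLBox.mp (.taut (by intro f hn hi; simp only [Formula.or, dia, hi, hn]; tauto)) h)
  generalize A.or B.dia = E at base
  induction Cs generalizing E with
  | nil => exact base
  | cons C Cs ih =>
    refine ih (fun C' hC' => hCs C' (by simp [hC'])) (E.or (box C)) ?_
    rcases FOLBox.box_or_neg_box (hCs C (by simp)) with h | h
    · exact Or.inl
        (FOLBox.mp (.taut (by intro f hn hi; simp only [Formula.or, hi, hn]; tauto)) h)
    · rcases base with hE | ⟨A', hA', h₁, h₂⟩
      · exact Or.inl
          (FOLBox.mp (.taut (by intro f hn hi; simp only [Formula.or, hi, hn]; tauto)) hE)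
      · exact Or.inr ⟨A', hA',
          FOLBox.mp₂ (.taut (by intro f hn hi; simp only [Formula.or, hi, hn]; tauto)) h h₁,
          FOLBox.mp (.taut (by intro f hn hi; simp only [Formula.or, hi, hn]; tauto)) h₂⟩

theorem ElemDisj.box_or_neg_box {D : Formula} (hD : ElemDisj D) :
    FOLBox (box D) ∨ FOLBox (neg (box D)) := by
  rcases hD.provable_or_equiv_boxFree with h | ⟨A, hA, h₁, h₂⟩
  · exact Or.inl h.nec
  · rcases FOLBox.box_or_neg_box hA with h | h
    · exact Or.inl (FOLBox.axK.mp₂ h₂.nec h)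
    · exact Or.inr (FOLBox.mp₂ (.taut (by intro f hn hi; simp only [hi, hn]; tauto))
        (FOLBox.axK.mp h₁.nec) h)

theorem MaxConsistent.not_mem_of_provable_neg {Γ : Set Formula} (hΓ : MaxConsistent Γ)
    {B : Formula} (h : FOLBox (neg B)) : B ∉ Γ := fun hB =>
  hΓ.1 [B] (by simp) (by simpa using hB) h

theorem MaxConsistent.mem_of_provable {Γ : Set Formula} (hΓ : MaxConsistent Γ)
    {B : Formula} (h : FOLBox B) : B ∈ Γ :=
  (hΓ.2 B).resolve_right <| hΓ.not_mem_of_provable_neg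
    (FOLBox.mp (.taut (by intro f hn hi; simp only [hi, hn]; tauto)) h)

/-- for Γ, Δ ∈ MC and any elementary disjunction D,
□D ∈ Γ iff □D ∈ Δ. -/
theorem box_elemdisj_agree (Γ Δ : Set Formula) (hΓ : Γ ∈ MC) (hΔ : Δ ∈ MC)
    (D : Formula) (hD : ElemDisj D) :
    Formula.box D ∈ Γ ↔ Formula.box D ∈ Δ := by
  rcases hD.box_or_neg_box with h | h
  · exact iff_of_true (hΓ.2.mem_of_provable h) (hΔ.2.mem_of_provable h)
  · exact iff_of_false (hΓ.2.not_mem_of_provable_neg h) (hΔ.2.not_mem_of_provable_neg h)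

end FOLBoxPaper
end

section
/- For all formulas A, B and every variable x, the formula ∀x(A ∨ □B) ↔ (∀xA ∨ □B) is provable in FOL□. -/
namespace FOLBoxPaper

open Formula

namespace Formula

theorem subst_self (A : Formula) (x : ℕ) : A.subst x x = A := by
  induction A with
  | atom j args =>
    simp only [subst, atom.injEq, true_and]
    conv_rhs => rw [← List.map_id args]
    refine List.map_congr_left fun z _ => ?_
    split_ifs with h <;> simp [h]
  | eq a b => simp only [subst, eq.injEq]; constructor <;> split_ifs with h <;> simp [h]
  | neg A ih => simp [subst, ih]
  | imp A B ihA ihB => simp [subst, ihA, ihB]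
  | all z A ih => simp [subst, ih]
  | box A _ => rfl

theorem substitutable_self (A : Formula) (x : ℕ) : Substitutable x x A := by
  induction A with
  | atom | eq | box => trivial
  | neg A ih => exact ih
  | imp A B ihA ihB => exact ⟨ihA, ihB⟩
  | all z A ih => exact (eq_or_ne z x).imp_right fun h => Or.inr ⟨h, ih⟩

end Formula

namespace FOLBox

theorem gen_s9 {A : Formula} (x : ℕ) (h : FOLBox A) : FOLBox (all x A) :=
  mp axMix (nec h)

theorem all_imp_self (A : Formula) (x : ℕ) : FOLBox ((all x A).imp A) := by
  simpa only [subst_self] using axAll1 (substitutable_self A x)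

theorem imp_all_s9 {A B : Formula} {x : ℕ} (hx : ¬ FreeIn x A) (h : FOLBox (A.imp B)) :
    FOLBox (A.imp (all x B)) :=
  mp (axAll2 hx) (gen_s9 x h)

end FOLBox

/-- ∀x(A ∨ □B) ↔ (∀xA ∨ □B) is provable in FOL□. -/
theorem all_or_box (A B : Formula) (x : ℕ) :
    FOLBox ((Formula.all x (A.or (Formula.box B))).iff
      ((Formula.all x A).or (Formula.box B))) := by
  have forward : FOLBox (((all x (A.or (box B))).and (neg (box B))).imp (all x A)) := by
    refine FOLBox.imp_all_s9 (by simp [Formula.and, FreeIn])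
      (.mp (.taut fun f hn hi => ?_) (FOLBox.all_imp_self (A.or (box B)) x))
    simp only [Formula.and, Formula.or, hn, hi]
    tauto
  have backward : FOLBox (((all x A).or (box B)).imp (all x (A.or (box B)))) := by
    refine FOLBox.imp_all_s9 (by simp [Formula.or, FreeIn])
      (.mp (.taut fun f hn hi => ?_) (FOLBox.all_imp_self A x))
    simp only [Formula.or, hn, hi]
    tauto
  refine .mp (.mp (.taut fun f hn hi => ?_) forward) backward
  simp only [Formula.iff, Formula.and, Formula.or, hn, hi]
  tauto

end FOLBoxPaper
end
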